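/- arXiv:2010.08393 — 8 statements merged into one kernel-verified Lean document; each statement's English description precedes it below -/
import Mathlib

section
/- The set of projective transformations of ℙ³(ℂ) that map V onto itself is finite and has exactly 24 elements; that is, the set of matrices A ∈ GL₄(ℂ), taken up to nonzero scalar multiples, whose induced action on ℙ³(ℂ) satisfies A·V = V, has cardinality 24. -/
/-- The quartic form defining the Roman (Steiner) surface. -/
noncomputable def romanQ (z : Fin 4 → ℂ) : ℂ :=
  (z 1) ^ 2 * (z 2) ^ 2 + (z 1) ^ 2 * (z 3) ^ 2 + (z 2) ^ 2 * (z 3) ^ 2 -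
    z 0 * z 1 * z 2 * z 3

/-- The Roman surface `V ⊆ ℙ³(ℂ)`. -/
noncomputable def romanV : Set (Projectivization ℂ (Fin 4 → ℂ)) :=
  {p | romanQ p.rep = 0}

/-- The projective transformation of `ℙ³(ℂ)` induced by an invertible matrix. -/
noncomputable def act (A : GL (Fin 4) ℂ) :
    Projectivization ℂ (Fin 4 → ℂ) → Projectivization ℂ (Fin 4 → ℂ) :=
  Projectivization.map (Matrix.mulVecLin (A : Matrix (Fin 4) (Fin 4) ℂ))
    (by
      intro x y h
      apply (Matrix.GeneralLinearGroup.toLin A).toLinearEquiv.injective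
      simpa [Matrix.GeneralLinearGroup.toLin_apply] using h)

theorem romanQ_smul (c : ℂ) (z : Fin 4 → ℂ) : romanQ (c • z) = c ^ 4 * romanQ z := by
  simp only [romanQ, Pi.smul_apply, smul_eq_mul]
  ring

theorem mk_mem_romanV {v : Fin 4 → ℂ} (hv : v ≠ 0) :
    Projectivization.mk ℂ v hv ∈ romanV ↔ romanQ v = 0 := by
  obtain ⟨a, ha⟩ := Projectivization.exists_smul_eq_mk_rep ℂ v hv
  have ha' : (a : ℂ) • v = (Projectivization.mk ℂ v hv).rep := ha
  change romanQ (Projectivization.mk ℂ v hv).rep = 0 ↔ _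
  rw [← ha', romanQ_smul]
  simp

theorem mulVec_ne_zero (A : GL (Fin 4) ℂ) {v : Fin 4 → ℂ} (hv : v ≠ 0) :
    (A : Matrix (Fin 4) (Fin 4) ℂ).mulVec v ≠ 0 := by
  intro h
  refine hv (Matrix.mulVec_injective_of_isUnit A.isUnit ?_)
  simpa using h

theorem act_mk (A : GL (Fin 4) ℂ) {v : Fin 4 → ℂ} (hv : v ≠ 0) :
    act A (Projectivization.mk ℂ v hv) =
      Projectivization.mk ℂ ((A : Matrix (Fin 4) (Fin 4) ℂ).mulVec v) (mulVec_ne_zero A hv) :=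
  rfl

/-- The Roman form written symmetrically in its last three variables. -/
theorem romanQ_eq_symmetric (z : Fin 4 → ℂ) :
    romanQ z = ((∑ k : Fin 3, z k.succ ^ 2) ^ 2 - ∑ k : Fin 3, z k.succ ^ 4) / 2 -
      z 0 * ∏ k : Fin 3, z k.succ := by
  simp [romanQ, Fin.sum_univ_three, Fin.prod_univ_three]
  ring

theorem romanQ_perm (σ : Equiv.Perm (Fin 3)) (z : Fin 4 → ℂ) :
    romanQ (Fin.cons (z 0) fun k => z (σ k).succ) = romanQ z := by
  simp only [romanQ_eq_symmetric, Fin.cons_zero, Fin.cons_succ]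
  rw [Equiv.sum_comp σ fun k => z k.succ ^ 2, Equiv.sum_comp σ fun k => z k.succ ^ 4,
    Equiv.prod_comp σ fun k => z k.succ]

/-- If a product of two binary linear forms vanishes identically, one of the forms is zero. -/
theorem linear_form_eq_zero_of_mul {a b c d : ℂ}
    (h : ∀ s t : ℂ, (s * a + t * b) * (s * c + t * d) = 0) :
    (a = 0 ∧ b = 0) ∨ (c = 0 ∧ d = 0) := by
  have h₁ := h 1 0
  have h₂ := h 0 1
  have h₃ := h 1 1
  grind

/-- Coordinate form of the classification of the lines contained in the Roman surface. -/
theorem double_line_coordinates {u₀ u₁ u₂ u₃ v₀ v₁ v₂ v₃ : ℂ}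
    (hind : ∀ s t : ℂ, s * u₀ + t * v₀ = 0 → s * u₁ + t * v₁ = 0 → s * u₂ + t * v₂ = 0 →
      s * u₃ + t * v₃ = 0 → s = 0 ∧ t = 0)
    (hq : ∀ s t : ℂ, (s * u₁ + t * v₁) ^ 2 * (s * u₂ + t * v₂) ^ 2 +
      (s * u₁ + t * v₁) ^ 2 * (s * u₃ + t * v₃) ^ 2 +
      (s * u₂ + t * v₂) ^ 2 * (s * u₃ + t * v₃) ^ 2 -
      (s * u₀ + t * v₀) * (s * u₁ + t * v₁) * (s * u₂ + t * v₂) * (s * u₃ + t * v₃) = 0) :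
    ((u₂ = 0 ∧ v₂ = 0) ∧ (u₃ = 0 ∧ v₃ = 0)) ∨ ((u₁ = 0 ∧ v₁ = 0) ∧ (u₃ = 0 ∧ v₃ = 0)) ∨
      ((u₁ = 0 ∧ v₁ = 0) ∧ (u₂ = 0 ∧ v₂ = 0)) := by
  by_cases h₁ : u₁ = 0 ∧ v₁ = 0
  · have := linear_form_eq_zero_of_mul (a := u₂) (b := v₂) (c := u₃) (d := v₃)
      fun s t => by simpa [h₁.1, h₁.2] using hq s t
    tauto
  by_cases h₂ : u₂ = 0 ∧ v₂ = 0
  · have := linear_form_eq_zero_of_mul (a := u₁) (b := v₁) (c := u₃) (d := v₃)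
      fun s t => by simpa [h₂.1, h₂.2] using hq s t
    tauto
  by_cases h₃ : u₃ = 0 ∧ v₃ = 0
  · have := linear_form_eq_zero_of_mul (a := u₁) (b := v₁) (c := u₂) (d := v₂)
      fun s t => by simpa [h₃.1, h₃.2] using hq s t
    tauto
  exfalso
  have p₁ : (v₁ * u₂ - u₁ * v₂) * (v₁ * u₃ - u₁ * v₃) = 0 := by
    rw [← sq_eq_zero_iff]
    linear_combination hq v₁ (-u₁)
  have p₂ : (v₁ * u₂ - u₁ * v₂) * (v₂ * u₃ - u₂ * v₃) = 0 := by
    rw [← sq_eq_zero_iff]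
    linear_combination hq v₂ (-u₂)
  have p₃ : (v₁ * u₃ - u₁ * v₃) * (v₂ * u₃ - u₂ * v₃) = 0 := by
    rw [← sq_eq_zero_iff]
    linear_combination hq v₃ (-u₃)
  have h₁₂ : v₁ * u₂ - u₁ * v₂ = 0 := by grind
  have h₁₃ : v₁ * u₃ - u₁ * v₃ = 0 := by grind
  have hd : v₁ * u₀ - u₁ * v₀ ≠ 0 := fun hd => by
    have := hind v₁ (-u₁) (by linear_combination hd) (by ring) (by linear_combination h₁₂)
      (by linear_combination h₁₃)
    exact h₁ ⟨neg_eq_zero.mp this.2, this.1⟩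
  have key : ∀ s t : ℂ,
      (v₁ * u₀ - u₁ * v₀) * ((s * u₁ + t * v₁) * (s * u₂ + t * v₂) * (s * u₃ + t * v₃)) = 0 := by
    intro s t
    have h := hq (s + v₁) (t - u₁)
    have e₁ : (s + v₁) * u₁ + (t - u₁) * v₁ = s * u₁ + t * v₁ := by ring
    have e₂ : (s + v₁) * u₂ + (t - u₁) * v₂ = s * u₂ + t * v₂ := by linear_combination h₁₂
    have e₃ : (s + v₁) * u₃ + (t - u₁) * v₃ = s * u₃ + t * v₃ := by linear_combination h₁₃
    rw [e₁, e₂, e₃] at h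
    linear_combination hq s t - h
  have k₁ := key 1 0
  have k₂ := key 0 1
  simp only [one_mul, zero_mul, add_zero, zero_add, mul_eq_zero, hd, false_or] at k₁ k₂
  grind

/-- Every line contained in the Roman surface is one of its three double lines. -/
theorem exists_double_line {u v : Fin 4 → ℂ}
    (hind : ∀ s t : ℂ, s • u + t • v = 0 → s = 0 ∧ t = 0)
    (h : ∀ s t : ℂ, romanQ (s • u + t • v) = 0) :
    ∃ m : Fin 3, ∀ i, i ≠ m → u i.succ = 0 ∧ v i.succ = 0 := by
  have := double_line_coordinates (u₀ := u 0) (u₁ := u 1) (u₂ := u 2) (u₃ := u 3)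
    (v₀ := v 0) (v₁ := v 1) (v₂ := v 2) (v₃ := v 3)
    (fun s t e₀ e₁ e₂ e₃ => hind s t (by
      ext i
      fin_cases i
      exacts [e₀, e₁, e₂, e₃]))
    (fun s t => by simpa [romanQ] using h s t)
  rcases this with h | h | h
  · exact ⟨0, by simpa [Fin.forall_fin_succ] using h⟩
  · exact ⟨1, by simpa [Fin.forall_fin_succ] using h⟩
  · exact ⟨2, by simpa [Fin.forall_fin_succ] using h⟩

/-- The signs with product one determined by their first two entries. -/
def evenSigns (ε : ℤˣ × ℤˣ) : Fin 3 → ℤˣ := ![ε.1, ε.2, ε.1 * ε.2]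

/-- The matrix fixing the first basis vector and sending the basis vector with index `k.succ` to
`evenSigns ε k` times the one with index `(σ k).succ`. -/
def signedPerm (p : Equiv.Perm (Fin 3) × (ℤˣ × ℤˣ)) : Matrix (Fin 4) (Fin 4) ℂ :=
  Matrix.of (Fin.cons (Fin.cons 1 fun _ => 0)
    fun i => Fin.cons 0 fun k => if k = p.1.symm i then ((evenSigns p.2 k : ℤ) : ℂ) else 0)

theorem signedPerm_mulVec_zero (p : Equiv.Perm (Fin 3) × (ℤˣ × ℤˣ)) (v : Fin 4 → ℂ) :
    (signedPerm p).mulVec v 0 = v 0 := by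
  simp [signedPerm, Matrix.mulVec, dotProduct, Fin.sum_univ_succ]

theorem signedPerm_mulVec_succ (p : Equiv.Perm (Fin 3) × (ℤˣ × ℤˣ)) (v : Fin 4 → ℂ) (k : Fin 3) :
    (signedPerm p).mulVec v (p.1 k).succ = ((evenSigns p.2 k : ℤ) : ℂ) * v k.succ := by
  simp [signedPerm, Matrix.mulVec, dotProduct, Fin.sum_univ_succ (n := 3)]

theorem isUnit_signedPerm (p : Equiv.Perm (Fin 3) × (ℤˣ × ℤˣ)) : IsUnit (signedPerm p) := by
  rw [← Matrix.mulVec_injective_iff_isUnit]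
  intro v w h
  ext i
  refine Fin.cases ?_ (fun k => ?_) i
  · simpa [signedPerm_mulVec_zero] using congrFun h 0
  · simpa [signedPerm_mulVec_succ] using congrFun h (p.1 k).succ

theorem romanQ_signedPerm (p : Equiv.Perm (Fin 3) × (ℤˣ × ℤˣ)) (v : Fin 4 → ℂ) :
    romanQ ((signedPerm p).mulVec v) = romanQ v := by
  rw [← romanQ_perm p.1]
  simp only [signedPerm_mulVec_zero, signedPerm_mulVec_succ]
  obtain ⟨σ, ε, δ⟩ := p
  rcases Int.units_eq_one_or ε with rfl | rfl <;> rcases Int.units_eq_one_or δ with rfl | rfl <;>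
    simp [romanQ_eq_symmetric, evenSigns, Fin.sum_univ_three, Fin.prod_univ_three,
      Even.neg_pow (by decide : Even 4)]

open Matrix in
/-- An invertible matrix sends distinct double lines to distinct double lines. -/
theorem double_lines_injective {A : Matrix (Fin 4) (Fin 4) ℂ} (hA : IsUnit A) {m : Fin 3 → Fin 3}
    (hm : ∀ k i, i ≠ m k → A i.succ 0 = 0 ∧ A i.succ k.succ = 0) : Function.Injective m := by
  intro k l hkl
  by_contra hne
  obtain ⟨n, hn⟩ : ∃ n, ∀ j, j = k ∨ j = l ∨ j = n := by
    clear hkl hm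
    decide +revert
  obtain ⟨i, j, hij, hi, hj⟩ : ∃ i j, i ≠ j ∧ i ≠ m k ∧ j ≠ m k := by
    generalize m k = a
    decide +revert
  have row : ∀ i, i ≠ m k → ∀ a, a ≠ n.succ → A i.succ a = 0 := by
    intro i hi a
    refine Fin.cases (fun _ => (hm k i hi).1) (fun b hb => ?_) a
    rcases hn b with rfl | rfl | rfl
    · exact (hm _ i hi).2
    · exact (hm _ i (hkl ▸ hi)).2
    · exact absurd rfl hb
  have hinj := Matrix.vecMul_injective_of_isUnit hA
  have hzero : ∀ w, w ᵥ* A = 0 → w = 0 := fun w hw => hinj (by simpa using hw)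
  have hne' : i.succ ≠ j.succ := fun h => hij (Fin.succ_injective _ h)
  have hjn : A j.succ n.succ = 0 := by
    have := congrFun (hzero (Pi.single i.succ (A j.succ n.succ) - Pi.single j.succ (A i.succ n.succ))
      (by
        ext a
        by_cases ha : a = n.succ
        · subst ha
          simp [Matrix.sub_vecMul, mul_comm]
        · simp [Matrix.sub_vecMul, row i hi a ha, row j hj a ha])) i.succ
    simpa [hne'] using this
  have := congrFun (hzero (Pi.single j.succ 1) (by
    ext a
    by_cases ha : a = n.succ
    · simp [ha, hjn]
    · simp [row j hj a ha])) j.succ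
  simp at this

theorem exists_perm_of_romanQ {A : Matrix (Fin 4) (Fin 4) ℂ} (hA : IsUnit A)
    (h : ∀ v, romanQ v = 0 → romanQ (A.mulVec v) = 0) :
    ∃ σ : Equiv.Perm (Fin 3), (∀ i : Fin 3, A i.succ 0 = 0) ∧
      ∀ k i, i ≠ σ k → A i.succ k.succ = 0 := by
  have line : ∀ k : Fin 3, ∃ m : Fin 3, ∀ i, i ≠ m → A i.succ 0 = 0 ∧ A i.succ k.succ = 0 := by
    intro k
    have comb : ∀ s t : ℂ, s • A.col 0 + t • A.col k.succ =
        A.mulVec (Pi.single 0 s + Pi.single k.succ t) := by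
      intro s t
      ext i
      simp [Matrix.mulVec_add]
    refine exists_double_line (u := A.col 0) (v := A.col k.succ) (fun s t hst => ?_) fun s t => ?_
    · rw [comb] at hst
      have := Matrix.mulVec_injective_of_isUnit hA (hst.trans (Matrix.mulVec_zero A).symm)
      exact ⟨by simpa using congrFun this 0, by simpa using congrFun this k.succ⟩
    · rw [comb]
      apply h
      fin_cases k <;> simp [romanQ]
  choose m hm using line
  have hinj := double_lines_injective hA hm
  refine ⟨Equiv.ofBijective m (Finite.injective_iff_bijective.mp hinj), fun i => ?_,
    fun k i hi => (hm k i hi).2⟩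
  by_cases hi : i = m 0
  · exact (hm 1 i (by rw [hi]; exact hinj.ne (by decide))).1
  · exact (hm 0 i hi).1

/-- A diagonal-plus-first-row substitution preserving the Roman surface is a diagonal sign change
up to a scalar. -/
theorem coefficients_of_romanQ {a c₁ c₂ c₃ b₁ b₂ b₃ : ℂ} (h₁ : b₁ ≠ 0) (h₂ : b₂ ≠ 0) (h₃ : b₃ ≠ 0)
    (h : ∀ x y w : ℂ, romanQ ![a * (x ^ 2 + y ^ 2 + w ^ 2) + c₁ * (y * w) + c₂ * (x * w) +
      c₃ * (x * y), b₁ * (y * w), b₂ * (x * w), b₃ * (x * y)] = 0) :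
    (c₁ = 0 ∧ c₂ = 0 ∧ c₃ = 0) ∧ b₁ * b₂ = a * b₃ ∧ b₁ * b₃ = a * b₂ ∧ b₂ * b₃ = a * b₁ := by
  have hB : b₁ * b₂ * b₃ ≠ 0 := by simp [*]
  have key : ∀ x y w : ℂ, x * y * w ≠ 0 → (b₁ * b₂) ^ 2 * w ^ 2 + (b₁ * b₃) ^ 2 * y ^ 2 +
      (b₂ * b₃) ^ 2 * x ^ 2 - b₁ * b₂ * b₃ * (a * (x ^ 2 + y ^ 2 + w ^ 2) + c₁ * (y * w) +
      c₂ * (x * w) + c₃ * (x * y)) = 0 := by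
    intro x y w hx
    have := h x y w
    simp only [romanQ, Matrix.cons_val] at this
    refine (mul_eq_zero.mp (?_ : (x * y * w) ^ 2 * _ = 0)).resolve_left (pow_ne_zero 2 hx)
    linear_combination this
  have k₀ := key 1 1 1 (by norm_num)
  have k₁ := key (-1) 1 1 (by norm_num)
  have k₂ := key 1 (-1) 1 (by norm_num)
  have k₃ := key 1 1 (-1) (by norm_num)
  have l₁ := key 2 1 1 (by norm_num)
  have l₂ := key 1 2 1 (by norm_num)
  have l₃ := key 1 1 2 (by norm_num)
  have e₁ : c₁ = 0 := by
    refine (mul_eq_zero.mp (?_ : b₁ * b₂ * b₃ * c₁ = 0)).resolve_left hB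
    linear_combination (-k₀ - k₁ + k₂ + k₃) / 4
  have e₂ : c₂ = 0 := by
    refine (mul_eq_zero.mp (?_ : b₁ * b₂ * b₃ * c₂ = 0)).resolve_left hB
    linear_combination (-k₀ + k₁ - k₂ + k₃) / 4
  have e₃ : c₃ = 0 := by
    refine (mul_eq_zero.mp (?_ : b₁ * b₂ * b₃ * c₃ = 0)).resolve_left hB
    linear_combination (-k₀ + k₁ + k₂ - k₃) / 4
  subst e₁ e₂ e₃
  refine ⟨⟨rfl, rfl, rfl⟩, ?_, ?_, ?_⟩
  · refine mul_left_cancel₀ (mul_ne_zero h₁ h₂) ?_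
    linear_combination (l₃ - k₀) / 3
  · refine mul_left_cancel₀ (mul_ne_zero h₁ h₃) ?_
    linear_combination (l₂ - k₀) / 3
  · refine mul_left_cancel₀ (mul_ne_zero h₂ h₃) ?_
    linear_combination (l₁ - k₀) / 3

theorem exists_unit_of_sq_eq {a b : ℂ} (h : b ^ 2 = a ^ 2) : ∃ e : ℤˣ, b = a * ((e : ℤ) : ℂ) := by
  rcases sq_eq_sq_iff_eq_or_eq_neg.mp h with h | h
  · exact ⟨1, by simp [h]⟩
  · exact ⟨-1, by simp [h]⟩

theorem exists_signs {a b₁ b₂ b₃ : ℂ} (h₁ : b₁ ≠ 0) (h₂ : b₂ ≠ 0) (ha : a ≠ 0)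
    (h₁₂ : b₁ * b₂ = a * b₃) (h₁₃ : b₁ * b₃ = a * b₂) (h₂₃ : b₂ * b₃ = a * b₁) :
    ∃ ε : ℤˣ × ℤˣ, ∀ k : Fin 3, ![b₁, b₂, b₃] k = a * ((evenSigns ε k : ℤ) : ℂ) := by
  obtain ⟨ε, hε⟩ := exists_unit_of_sq_eq (a := a) (b := b₁) (by
    refine mul_left_cancel₀ h₂ ?_
    linear_combination b₁ * h₁₂ + a * h₁₃)
  obtain ⟨δ, hδ⟩ := exists_unit_of_sq_eq (a := a) (b := b₂) (by
    refine mul_left_cancel₀ h₁ ?_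
    linear_combination b₂ * h₁₂ + a * h₂₃)
  refine ⟨(ε, δ), ?_⟩
  have h₃ : b₃ = a * (((ε * δ : ℤˣ) : ℤ) : ℂ) := by
    refine mul_left_cancel₀ ha ?_
    rw [← h₁₂, hε, hδ]
    push_cast
    ring
  simp [Fin.forall_fin_succ, evenSigns, ← hε, ← hδ, h₃]

theorem eq_smul_signedPerm {A : Matrix (Fin 4) (Fin 4) ℂ} (hA : IsUnit A)
    (h : ∀ v, romanQ v = 0 → romanQ (A.mulVec v) = 0) :
    ∃ (a : ℂ) (p : _), A = a • signedPerm p := by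
  obtain ⟨σ, h₀, hσ⟩ := exists_perm_of_romanQ hA h
  have hzero : ∀ w, A.mulVec w = 0 → w = 0 := fun w hw =>
    Matrix.mulVec_injective_of_isUnit hA (by simpa using hw)
  have ha : A 0 0 ≠ 0 := by
    intro ha
    have := congrFun (hzero (Pi.single 0 1) (by
      ext i
      refine Fin.cases ?_ (fun k => ?_) i
      · simpa using ha
      · simpa using h₀ k)) 0
    simp at this
  have hb : ∀ k, A (σ k).succ k.succ ≠ 0 := by
    intro k hk
    have := congrFun (hzero (Pi.single 0 (A 0 k.succ) - Pi.single k.succ (A 0 0)) (by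
      ext i
      refine Fin.cases ?_ (fun j => ?_) i
      · simp [Matrix.mulVec_sub, mul_comm (A 0 0)]
      · by_cases hj : j = σ k
        · simp [Matrix.mulVec_sub, hj, h₀, hk]
        · simp [Matrix.mulVec_sub, h₀, hσ k j hj])) k.succ
    exact ha (by simpa using this)
  have hsucc : ∀ v k, A.mulVec v (σ k).succ = A (σ k).succ k.succ * v k.succ := by
    intro v k
    rw [Matrix.mulVec, dotProduct, Fin.sum_univ_succ, h₀, zero_mul, zero_add]
    refine Finset.sum_eq_single k (fun j _ hj => ?_) (by simp)
    rw [hσ j _ (σ.injective.ne hj.symm), zero_mul]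
  obtain ⟨⟨c₁, c₂, c₃⟩, e₁₂, e₁₃, e₂₃⟩ := coefficients_of_romanQ (a := A 0 0)
    (c₁ := A 0 1) (c₂ := A 0 2) (c₃ := A 0 3) (hb 0) (hb 1) (hb 2) (by
      intro x y w
      have := h ![x ^ 2 + y ^ 2 + w ^ 2, y * w, x * w, x * y] (by
        simp only [romanQ, Matrix.cons_val]
        ring)
      rw [← romanQ_perm σ] at this
      simp only [hsucc] at this
      rw [← this]
      congr 1
      ext i
      fin_cases i
      · simp [Matrix.mulVec, dotProduct, Fin.sum_univ_succ]
        ring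
      all_goals rfl)
  obtain ⟨ε, hε⟩ := exists_signs (hb 0) (hb 1) ha e₁₂ e₁₃ e₂₃
  have hε' : ∀ k, A (σ k).succ k.succ = A 0 0 * ((evenSigns ε k : ℤ) : ℂ) := by
    intro k
    rw [← hε k]
    fin_cases k <;> rfl
  refine ⟨A 0 0, (σ, ε), ?_⟩
  ext i j
  refine Fin.cases ?_ (fun i => ?_) i <;> refine Fin.cases ?_ (fun j => ?_) j
  · simp [signedPerm]
  · have : A 0 j.succ = 0 := by
      fin_cases j
      exacts [c₁, c₂, c₃]
    simp [signedPerm, this]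
  · simp [signedPerm, h₀]
  · by_cases hij : i = σ j
    · simp [signedPerm, hij, hε']
    · have : j ≠ σ.symm i := fun h => hij (by simp [h])
      simp [signedPerm, hσ j i hij, this]

/-- The matrix `signedPerm p` as an element of the general linear group. -/
noncomputable def signedPermGL (p : Equiv.Perm (Fin 3) × (ℤˣ × ℤˣ)) : GL (Fin 4) ℂ :=
  (isUnit_signedPerm p).unit

theorem act_signedPermGL_injective : Function.Injective fun p => act (signedPermGL p) := by
  intro p p' h
  have key : ∀ k : Fin 3, (signedPerm p).mulVec (Pi.single 0 1 + Pi.single k.succ 1) =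
      (signedPerm p').mulVec (Pi.single 0 1 + Pi.single k.succ 1) := by
    intro k
    have hv : (Pi.single 0 1 + Pi.single k.succ 1 : Fin 4 → ℂ) ≠ 0 := fun h => by
      simpa using congrFun h 0
    have := congrFun h (Projectivization.mk ℂ _ hv)
    simp only [act_mk] at this
    obtain ⟨c, hc⟩ := (Projectivization.mk_eq_mk_iff' ..).mp this
    change c • (signedPerm p').mulVec _ = (signedPerm p).mulVec _ at hc
    have hc₀ := congrFun hc 0
    have : c = 1 := by simpa [signedPerm_mulVec_zero] using hc₀
    rw [← hc, this, one_smul]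
  have coord : ∀ k, p.1 k = p'.1 k ∧ evenSigns p.2 k = evenSigns p'.2 k := by
    intro k
    have hk := congrFun (key k) (p.1 k).succ
    rw [signedPerm_mulVec_succ] at hk
    obtain ⟨l, hl⟩ := p'.1.surjective (p.1 k)
    rw [← hl, signedPerm_mulVec_succ] at hk
    have hlk : l = k := by
      by_contra hne
      simp [hne] at hk
    subst hlk
    refine ⟨hl.symm, ?_⟩
    simpa [Units.ext_iff] using hk
  refine Prod.ext (Equiv.ext fun k => (coord k).1) (Prod.ext ?_ ?_)
  · exact (coord 0).2
  · exact (coord 1).2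

theorem act_eq_of_eq_smul {A B : GL (Fin 4) ℂ} {a : ℂ}
    (h : (A : Matrix (Fin 4) (Fin 4) ℂ) = a • (B : Matrix (Fin 4) (Fin 4) ℂ)) : act A = act B := by
  ext x
  induction x using Projectivization.ind with
  | h v hv =>
    rw [act_mk, act_mk, Projectivization.mk_eq_mk_iff']
    exact ⟨a, by rw [h, Matrix.smul_mulVec]⟩

theorem act_signedPermGL_image (p : Equiv.Perm (Fin 3) × (ℤˣ × ℤˣ)) :
    act (signedPermGL p) '' romanV = romanV := by
  have mem : ∀ x, act (signedPermGL p) x ∈ romanV ↔ x ∈ romanV := by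
    intro x
    induction x using Projectivization.ind with
    | h v hv =>
      rw [act_mk, mk_mem_romanV, mk_mem_romanV]
      change romanQ ((signedPerm p).mulVec v) = 0 ↔ _
      rw [romanQ_signedPerm]
  have surj : Function.Surjective (act (signedPermGL p)) := by
    intro y
    induction y using Projectivization.ind with
    | h v hv =>
      refine ⟨Projectivization.mk ℂ _ (mulVec_ne_zero (signedPermGL p)⁻¹ hv), ?_⟩
      simp [act_mk, Matrix.mulVec_mulVec]
  have pre : act (signedPermGL p) ⁻¹' romanV = romanV := Set.ext mem
  conv_lhs => rw [← pre]
  exact Set.image_preimage_eq romanV surj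

theorem stabilizer_eq_range :
    {φ : Projectivization ℂ (Fin 4 → ℂ) → Projectivization ℂ (Fin 4 → ℂ) |
      (∃ A : GL (Fin 4) ℂ, φ = act A) ∧ φ '' romanV = romanV} =
      Set.range fun p => act (signedPermGL p) := by
  ext φ
  constructor
  · rintro ⟨⟨A, rfl⟩, hA⟩
    obtain ⟨a, p, hp⟩ := eq_smul_signedPerm A.isUnit (fun v hv => by
      by_cases hv₀ : v = 0
      · simp [hv₀, romanQ]
      · rw [← mk_mem_romanV (mulVec_ne_zero A hv₀), ← act_mk A hv₀, ← hA]
        exact Set.mem_image_of_mem _ ((mk_mem_romanV hv₀).mpr hv))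
    exact ⟨p, (act_eq_of_eq_smul hp).symm⟩
  · rintro ⟨p, rfl⟩
    exact ⟨⟨_, rfl⟩, act_signedPermGL_image p⟩

/-- The group of projective transformations of `ℙ³(ℂ)` preserving the Roman
surface has exactly 24 elements.  (Transformations of `ℙ³(ℂ)` induced by
matrices correspond exactly to elements of `PGL₄(ℂ)`.) -/
theorem stmt1 :
    {φ : Projectivization ℂ (Fin 4 → ℂ) → Projectivization ℂ (Fin 4 → ℂ) |
      (∃ A : GL (Fin 4) ℂ, φ = act A) ∧ φ '' romanV = romanV}.ncard = 24 := by
  rw [stabilizer_eq_range, Set.ncard_range_of_injective act_signedPermGL_injective]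
  simp [Nat.card_eq_fintype_card, Fintype.card_perm, Nat.factorial]
end

section
/- The subgroup of PGL₄(ℂ) consisting of all projective transformations of ℙ³(ℂ) that map V onto itself is isomorphic, as a group, to the symmetric group on four letters (the symmetry group of the tetrahedron). -/
/-- The projective general linear group `PGL₄(ℂ)`: invertible `4 × 4` complex
matrices modulo (the central subgroup of) scalar matrices. -/
abbrev PGL4C := GL (Fin 4) ℂ ⧸ Subgroup.center (GL (Fin 4) ℂ)

open Matrix

namespace RomanSurface

theorem romanQ_smul (a : ℂ) (z : Fin 4 → ℂ) : romanQ (a • z) = a ^ 4 * romanQ z := by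
  simp only [romanQ, Pi.smul_apply, smul_eq_mul]
  ring

theorem mk_mem_romanV {v : Fin 4 → ℂ} (hv : v ≠ 0) :
    Projectivization.mk ℂ v hv ∈ romanV ↔ romanQ v = 0 := by
  obtain ⟨a, ha⟩ := Projectivization.exists_smul_eq_mk_rep ℂ v hv
  change romanQ _ = 0 ↔ _
  rw [← ha, Units.smul_def, romanQ_smul]
  simp

theorem mulVec_ne_zero (A : GL (Fin 4) ℂ) {v : Fin 4 → ℂ} (hv : v ≠ 0) :
    A.val *ᵥ v ≠ 0 := by
  intro h
  apply hv
  have := congrArg (fun w => A⁻¹.val *ᵥ w) h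
  simpa [mulVec_mulVec, ← Units.val_mul] using this

theorem act_mk (A : GL (Fin 4) ℂ) {v : Fin 4 → ℂ} (hv : v ≠ 0) :
    act A (Projectivization.mk ℂ v hv) =
      Projectivization.mk ℂ (A.val *ᵥ v) (mulVec_ne_zero A hv) :=
  rfl

theorem romanQ_mulVec_eq_zero {A : GL (Fin 4) ℂ} (hA : act A '' romanV = romanV)
    {z : Fin 4 → ℂ} (hz : romanQ z = 0) : romanQ (A.val *ᵥ z) = 0 := by
  by_cases h : z = 0
  · subst h
    simpa using hz
  · rw [← mk_mem_romanV (mulVec_ne_zero A h), ← act_mk A h, ← hA]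
    exact Set.mem_image_of_mem _ ((mk_mem_romanV h).2 hz)

theorem act_image_romanV {A : GL (Fin 4) ℂ} (hA : ∀ z, romanQ (A.val *ᵥ z) = romanQ z) :
    act A '' romanV = romanV := by
  apply Set.Subset.antisymm
  · rintro _ ⟨p, hp, rfl⟩
    induction p using Projectivization.ind with | h v hv
    rw [act_mk, mk_mem_romanV, hA]
    exact (mk_mem_romanV hv).1 hp
  · intro p hp
    induction p using Projectivization.ind with | h v hv
    have hAv : A.val *ᵥ (A⁻¹.val *ᵥ v) = v := by
      simp [mulVec_mulVec]
    refine ⟨Projectivization.mk ℂ (A⁻¹.val *ᵥ v) (mulVec_ne_zero _ hv), ?_, ?_⟩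
    · rw [mk_mem_romanV, ← hA, hAv]
      exact (mk_mem_romanV hv).1 hp
    · simp only [act_mk, hAv]

/-- On a line contained in the Roman surface, one of the last three coordinates vanishes. -/
theorem exists_coordinate_vanishing {u v : Fin 4 → ℂ}
    (hind : ∀ s t : ℂ, s • u + t • v = 0 → s = 0 ∧ t = 0)
    (hq : ∀ s t : ℂ, romanQ (s • u + t • v) = 0) :
    (u 1 = 0 ∧ v 1 = 0) ∨ (u 2 = 0 ∧ v 2 = 0) ∨ (u 3 = 0 ∧ v 3 = 0) := by
  simp only [romanQ, Pi.add_apply, Pi.smul_apply, smul_eq_mul] at hq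
  by_contra hne
  obtain ⟨h1, h2, h3⟩ : ¬(u 1 = 0 ∧ v 1 = 0) ∧ ¬(u 2 = 0 ∧ v 2 = 0) ∧ ¬(u 3 = 0 ∧ v 3 = 0) := by
    tauto
  have m1 : (v 1 * u 2 - u 1 * v 2) * (v 1 * u 3 - u 1 * v 3) = 0 := by
    rw [← pow_eq_zero_iff two_ne_zero]
    linear_combination hq (v 1) (-u 1)
  have m2 : (v 1 * u 2 - u 1 * v 2) * (v 2 * u 3 - u 2 * v 3) = 0 := by
    rw [← pow_eq_zero_iff two_ne_zero]
    linear_combination hq (v 2) (-u 2)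
  have m3 : (v 1 * u 3 - u 1 * v 3) * (v 2 * u 3 - u 2 * v 3) = 0 := by
    rw [← pow_eq_zero_iff two_ne_zero]
    linear_combination hq (v 3) (-u 3)
  -- the restrictions of the three coordinates to the line are proportional
  obtain ⟨d12, d13, d23⟩ : v 1 * u 2 - u 1 * v 2 = 0 ∧ v 1 * u 3 - u 1 * v 3 = 0 ∧
      v 2 * u 3 - u 2 * v 3 = 0 := by
    grind
  have hw : v 1 * u 0 - u 1 * v 0 ≠ 0 := by
    intro h0
    have := hind (v 1) (-u 1) (by
      ext i
      fin_cases i <;> simp <;> grind)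
    grind
  by_cases hu : u 1 = 0
  · have hv1 : v 1 ≠ 0 := fun h => h1 ⟨hu, h⟩
    have hv2 : v 2 ≠ 0 := by grind
    have hv3 : v 3 ≠ 0 := by grind
    have e1 := hq 0 1
    have e2 := hq (v 1) (1 - u 1)
    have f1 : v 1 * u 1 + (1 - u 1) * v 1 = v 1 := by ring
    have f2 : v 1 * u 2 + (1 - u 1) * v 2 = v 2 := by linear_combination d12
    have f3 : v 1 * u 3 + (1 - u 1) * v 3 = v 3 := by linear_combination d13
    rw [f1, f2, f3] at e2
    have : (v 1 * u 0 - u 1 * v 0) * (v 1 * v 2 * v 3) = 0 := by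
      linear_combination e1 - e2
    exact mul_ne_zero hw (mul_ne_zero (mul_ne_zero hv1 hv2) hv3) this
  · have hu2 : u 2 ≠ 0 := by grind
    have hu3 : u 3 ≠ 0 := by grind
    have e1 := hq 1 0
    have e2 := hq (1 + v 1) (- u 1)
    have f2 : (1 + v 1) * u 2 + -u 1 * v 2 = u 2 := by linear_combination d12
    have f3 : (1 + v 1) * u 3 + -u 1 * v 3 = u 3 := by linear_combination d13
    have f1 : (1 + v 1) * u 1 + -u 1 * v 1 = u 1 := by ring
    rw [f1, f2, f3] at e2
    have : (v 1 * u 0 - u 1 * v 0) * (u 1 * u 2 * u 3) = 0 := by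
      linear_combination e1 - e2
    exact mul_ne_zero hw (mul_ne_zero (mul_ne_zero hu hu2) hu3) this

/-- The only lines contained in the Roman surface are its three double lines. -/
theorem exists_double_line {u v : Fin 4 → ℂ} (hind : ∀ s t : ℂ, s • u + t • v = 0 → s = 0 ∧ t = 0)
    (hq : ∀ s t : ℂ, romanQ (s • u + t • v) = 0) :
    ∃ i : Fin 3, ∀ j, j ≠ i → u j.succ = 0 ∧ v j.succ = 0 := by
  have hv := exists_coordinate_vanishing hind hq
  simp only [romanQ, Pi.add_apply, Pi.smul_apply, smul_eq_mul] at hq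
  -- if one coordinate vanishes on the line, so does another one
  have aux : ∀ a b c d : ℂ, (∀ s t : ℂ, (s * a + t * b) ^ 2 * (s * c + t * d) ^ 2 = 0) →
      (a = 0 ∧ b = 0) ∨ (c = 0 ∧ d = 0) := by
    intro a b c d h
    have h₁ := h 1 0
    have h₂ := h 0 1
    have h₃ := h 1 1
    simp only [mul_eq_zero, pow_eq_zero_iff, one_mul, zero_mul, add_zero, zero_add, ne_eq,
      OfNat.ofNat_ne_zero, not_false_eq_true] at h₁ h₂ h₃
    grind
  have hzero : (u 2 = 0 ∧ v 2 = 0 ∧ u 3 = 0 ∧ v 3 = 0) ∨ (u 1 = 0 ∧ v 1 = 0 ∧ u 3 = 0 ∧ v 3 = 0) ∨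
      (u 1 = 0 ∧ v 1 = 0 ∧ u 2 = 0 ∧ v 2 = 0) := by
    rcases hv with h1 | h2 | h3
    · have := aux (u 2) (v 2) (u 3) (v 3) fun s t => by
        have := hq s t
        rw [h1.1, h1.2] at this
        linear_combination this
      tauto
    · have := aux (u 1) (v 1) (u 3) (v 3) fun s t => by
        have := hq s t
        rw [h2.1, h2.2] at this
        linear_combination this
      tauto
    · have := aux (u 1) (v 1) (u 2) (v 2) fun s t => by
        have := hq s t
        rw [h3.1, h3.2] at this
        linear_combination this
      tauto
  rcases hzero with h | h | h
  · exact ⟨0, fun j hj => by fin_cases j; exacts [absurd rfl hj, ⟨h.1, h.2.1⟩, h.2.2]⟩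
  · exact ⟨1, fun j hj => by fin_cases j; exacts [⟨h.1, h.2.1⟩, absurd rfl hj, h.2.2]⟩
  · exact ⟨2, fun j hj => by fin_cases j; exacts [⟨h.1, h.2.1⟩, h.2.2, absurd rfl hj]⟩

/-- A formula for `romanQ` which is visibly symmetric in the last three coordinates. -/
theorem romanQ_eq_symmetric (w : Fin 4 → ℂ) :
    romanQ w = ((∑ j : Fin 3, w j.succ ^ 2) ^ 2 - ∑ j : Fin 3, w j.succ ^ 4) / 2 -
      w 0 * ∏ j : Fin 3, w j.succ := by
  simp [romanQ, Fin.sum_univ_three, Fin.prod_univ_three]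
  ring

/-- A matrix preserving the Roman surface is block triangular, with a monomial `3 × 3` block. -/
theorem exists_monomial {A : GL (Fin 4) ℂ}
    (hA : ∀ z, romanQ z = 0 → romanQ (A.val *ᵥ z) = 0) :
    ∃ (a : ℂ) (b c : Fin 3 → ℂ) (τ : Equiv.Perm (Fin 3)), a ≠ 0 ∧ (∀ j, c j ≠ 0) ∧
      ∀ z : Fin 4 → ℂ, (A.val *ᵥ z) 0 = a * z 0 + ∑ j, b j * z j.succ ∧
        ∀ j, (A.val *ᵥ z) (τ j).succ = c j * z j.succ := by
  have ind : ∀ (j k : Fin 3) (x y w : ℂ), j ≠ k →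
      x • A.val.col 0 + y • A.val.col j.succ + w • A.val.col k.succ = 0 →
      x = 0 ∧ y = 0 ∧ w = 0 := by
    intro j k x y w hjk h
    by_contra hne
    refine mulVec_ne_zero A (v := Pi.single 0 x + Pi.single j.succ y + Pi.single k.succ w) ?_ ?_
    · intro h0
      apply hne
      have e0 := congrFun h0 0
      have e1 := congrFun h0 j.succ
      have e2 := congrFun h0 k.succ
      simp [Fin.succ_ne_zero, hjk, hjk.symm, (Fin.succ_ne_zero _).symm] at e0 e1 e2
      exact ⟨e0, e1, e2⟩
    · rw [← h]
      ext i
      simp [mulVec_add]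
  have ind₂ : ∀ (j : Fin 3) (x y : ℂ), x • A.val.col 0 + y • A.val.col j.succ = 0 →
      x = 0 ∧ y = 0 := by
    intro j x y h
    obtain ⟨k, hk⟩ := exists_ne j
    have := ind j k x y 0 hk.symm (by simpa using h)
    exact ⟨this.1, this.2.1⟩
  have line : ∀ k : Fin 3, ∃ i : Fin 3, ∀ j, j ≠ i →
      A.val j.succ 0 = 0 ∧ A.val j.succ k.succ = 0 := by
    intro k
    refine exists_double_line (u := A.val.col 0) (v := A.val.col k.succ) (ind₂ k) fun s t => ?_
    have := hA (Pi.single 0 s + Pi.single k.succ t) (by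
      fin_cases k <;> simp [romanQ])
    convert this using 2
    ext i
    simp [mulVec_add]
  choose τ hτ using line
  have hinj : Function.Injective τ := by
    intro j k hjk
    by_contra hne
    have hk := hτ k
    rw [← hjk] at hk
    have comb : ∀ x y w : ℂ,
        x * A.val 0 0 + y * A.val 0 j.succ + w * A.val 0 k.succ = 0 →
        x * A.val (τ j).succ 0 + y * A.val (τ j).succ j.succ + w * A.val (τ j).succ k.succ = 0 →
        x = 0 ∧ y = 0 ∧ w = 0 := by
      intro x y w h1 h2
      apply ind j k x y w hne
      ext i
      refine Fin.cases ?_ (fun i => ?_) i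
      · simpa using h1
      · by_cases hi : i = τ j
        · subst hi
          simpa using h2
        · simp [hτ j i hi, hk i hi]
    have c1 := comb (A.val 0 j.succ * A.val (τ j).succ k.succ - A.val (τ j).succ j.succ * A.val 0 k.succ)
      (A.val (τ j).succ 0 * A.val 0 k.succ - A.val 0 0 * A.val (τ j).succ k.succ)
      (A.val 0 0 * A.val (τ j).succ j.succ - A.val (τ j).succ 0 * A.val 0 j.succ)
      (by ring) (by ring)
    have c2 := comb (A.val (τ j).succ j.succ) (-A.val (τ j).succ 0) 0
      (by linear_combination c1.2.2) (by ring)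
    have c3 := comb (A.val 0 j.succ) (-A.val 0 0) 0 (by ring) (by linear_combination -c1.2.2)
    have c4 := comb 1 0 0 (by linear_combination -c3.2.1) (by linear_combination -c2.2.1)
    exact one_ne_zero c4.1
  have col0 : ∀ i : Fin 3, A.val i.succ 0 = 0 := by
    intro i
    obtain ⟨k, hk⟩ : ∃ k, i ≠ τ k := by
      by_contra! h
      exact absurd (hinj ((h 0).symm.trans (h 1))) (by decide)
    exact (hτ k i hk).1
  refine ⟨A.val 0 0, fun j => A.val 0 j.succ, fun j => A.val (τ j).succ j.succ,
    Equiv.ofBijective τ (Finite.injective_iff_bijective.1 hinj), ?_, ?_, fun z => ⟨?_, fun j => ?_⟩⟩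
  · intro h
    refine one_ne_zero (ind₂ 0 1 0 ?_).1
    ext i
    refine Fin.cases ?_ (fun i => ?_) i
    · simpa using h
    · simp [col0]
  · intro j h
    have key : ∀ x y : ℂ, x * A.val 0 0 + y * A.val 0 j.succ = 0 → x = 0 ∧ y = 0 := by
      intro x y h0
      apply ind₂ j
      ext i
      refine Fin.cases ?_ (fun i => ?_) i
      · simpa using h0
      · by_cases hi : i = τ j
        · subst hi
          simp [col0, h]
        · simp [col0, hτ j i hi]
    have k1 := key (A.val 0 j.succ) (-A.val 0 0) (by ring)
    exact one_ne_zero (key 1 0 (by linear_combination -k1.2)).1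
  · simp [mulVec, dotProduct, Fin.sum_univ_succ]
  · rw [Equiv.ofBijective_apply, mulVec, dotProduct, Fin.sum_univ_succ, col0,
      Finset.sum_eq_single j]
    · simp
    · intro k _ hk
      rw [(hτ k (τ j) (fun h => hk (hinj h).symm)).2, zero_mul]
    · simp

/-- The monomial form of a matrix preserving the Roman surface is that of a symmetry of the
tetrahedron. -/
theorem monomial_coefficients {a : ℂ} {b c : Fin 3 → ℂ} (hc : ∀ j, c j ≠ 0)
    (h : ∀ z : Fin 4 → ℂ, romanQ z = 0 →
      romanQ ![a * z 0 + ∑ j, b j * z j.succ, c 0 * z 1, c 1 * z 2, c 2 * z 3] = 0) :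
    b = 0 ∧ c 0 * c 1 = a * c 2 ∧ c 0 * c 2 = a * c 1 ∧ c 1 * c 2 = a * c 0 := by
  have pt : ∀ x y z : ℂ, _ := fun x y z => h ![x ^ 2 + y ^ 2 + z ^ 2, y * z, x * z, x * y] (by
    simp [romanQ]
    ring)
  simp [romanQ, Fin.sum_univ_three] at pt
  have hc' : c 0 * c 1 * c 2 ≠ 0 := by simp [hc]
  have p0 := pt 1 1 1
  have p1 := pt (-1) 1 1
  have p2 := pt 1 (-1) 1
  have p3 := pt 1 1 (-1)
  have q0 := pt 2 1 1
  have q1 := pt 1 2 1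
  have q2 := pt 1 1 2
  have b0 : b 0 = 0 := by
    apply (mul_eq_zero_iff_right hc').1
    linear_combination (p2 + p3 - p0 - p1) / 4
  have b1 : b 1 = 0 := by
    apply (mul_eq_zero_iff_right hc').1
    linear_combination (p1 + p3 - p0 - p2) / 4
  have b2 : b 2 = 0 := by
    apply (mul_eq_zero_iff_right hc').1
    linear_combination (p1 + p2 - p0 - p3) / 4
  rw [b0, b1, b2] at p0 q0 q1 q2
  refine ⟨by ext j; fin_cases j <;> assumption, ?_, ?_, ?_⟩
  · apply mul_left_cancel₀ (mul_ne_zero (hc 0) (hc 1))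
    linear_combination (q2 - 4 * p0) / 12
  · apply mul_left_cancel₀ (mul_ne_zero (hc 0) (hc 2))
    linear_combination (q1 - 4 * p0) / 12
  · apply mul_left_cancel₀ (mul_ne_zero (hc 1) (hc 2))
    linear_combination (q0 - 4 * p0) / 12

/-- The matrix whose columns are homogeneous coordinates of the vertices of the tetrahedron. -/
def vertexMatrix : Matrix (Fin 4) (Fin 4) ℂ :=
  !![1, 1, 1, 1; 1, 1, -1, -1; 1, -1, 1, -1; 1, -1, -1, 1]

theorem vertexMatrix_mul_self : vertexMatrix * vertexMatrix = (4 : ℂ) • 1 := by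
  ext i j
  fin_cases i <;> fin_cases j <;>
    simp [vertexMatrix, mul_apply, Fin.sum_univ_four] <;> norm_num

/-- `vertexMatrix` as an invertible matrix. -/
noncomputable def vertexGL : GL (Fin 4) ℂ where
  val := vertexMatrix
  inv := (4⁻¹ : ℂ) • vertexMatrix
  val_inv := by simp [vertexMatrix_mul_self]
  inv_val := by simp [vertexMatrix_mul_self]

/-- The action of `S₄` by invertible matrices permuting the vertices of the tetrahedron. -/
noncomputable def tetrahedralGL : Equiv.Perm (Fin 4) →* GL (Fin 4) ℂ :=
  (MulAut.conj vertexGL).toMonoidHom.comp (permMatrixHom (n := Fin 4) (R := ℂ)).toHomUnits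

theorem tetrahedralGL_mul_vertexGL (σ : Equiv.Perm (Fin 4)) :
    (tetrahedralGL σ).val * vertexMatrix = vertexMatrix * σ⁻¹.permMatrix ℂ := by
  have : tetrahedralGL σ * vertexGL =
      vertexGL * (permMatrixHom (n := Fin 4) (R := ℂ)).toHomUnits σ := by
    simp [tetrahedralGL]
  exact congrArg Units.val this

/-- In tetrahedral coordinates the quartic form is a symmetric polynomial. -/
theorem romanQ_vertexMatrix_mulVec (y : Fin 4 → ℂ) :
    romanQ (vertexMatrix *ᵥ y) =
      ((4 * ∑ i, y i ^ 2 - (∑ i, y i) ^ 2) ^ 2 -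
        (4 * (3 * (∑ i, y i ^ 2) ^ 2 - 2 * ∑ i, y i ^ 4 + 24 * ∏ i, y i) - (∑ i, y i) ^ 4)) / 2 -
      (∑ i, y i) * (((∑ i, y i) ^ 3 - 6 * (∑ i, y i) * (∑ i, y i ^ 2) + 8 * ∑ i, y i ^ 3) / 3) := by
  simp [romanQ, vertexMatrix, mulVec, dotProduct, Fin.sum_univ_four, Fin.prod_univ_four]
  ring

theorem romanQ_tetrahedralGL_mulVec (σ : Equiv.Perm (Fin 4)) (z : Fin 4 → ℂ) :
    romanQ ((tetrahedralGL σ).val *ᵥ z) = romanQ z := by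
  obtain ⟨y, rfl⟩ : ∃ y, z = vertexMatrix *ᵥ y :=
    ⟨vertexGL⁻¹.val *ᵥ z, by
      change z = vertexGL.val *ᵥ _
      simp [mulVec_mulVec]⟩
  rw [mulVec_mulVec, tetrahedralGL_mul_vertexGL, ← mulVec_mulVec, permMatrix_mulVec]
  simp only [romanQ_vertexMatrix_mulVec, Function.comp_apply]
  rw [Equiv.sum_comp σ⁻¹ y, Equiv.sum_comp σ⁻¹ (fun i => y i ^ 2),
    Equiv.sum_comp σ⁻¹ (fun i => y i ^ 3), Equiv.sum_comp σ⁻¹ (fun i => y i ^ 4),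
    Equiv.prod_comp σ⁻¹ y]

theorem exists_eq_smul_vertex {a : ℂ} {w : Fin 4 → ℂ} (ha : a ≠ 0) (h0 : w 0 = a)
    (hsq : ∀ j : Fin 3, w j.succ ^ 2 = a ^ 2) (hprod : ∏ j : Fin 3, w j.succ = a ^ 3) :
    ∃ k, w = a • vertexMatrix.col k := by
  have s1 := sq_eq_sq_iff_eq_or_eq_neg.1 (hsq 0)
  have s2 := sq_eq_sq_iff_eq_or_eq_neg.1 (hsq 1)
  have s3 : w 3 * w 1 * w 2 = a ^ 3 := by
    rw [← hprod, Fin.prod_univ_three]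
    simp
    ring
  simp at s1 s2
  have ext4 : ∀ k, w 0 = a * vertexMatrix 0 k → w 1 = a * vertexMatrix 1 k →
      w 2 = a * vertexMatrix 2 k → w 3 = a * vertexMatrix 3 k →
      ∃ k, w = a • vertexMatrix.col k := by
    intro k h0 h1 h2 h3
    refine ⟨k, ?_⟩
    ext i
    fin_cases i <;> simpa
  have ha2 : a ^ 2 ≠ 0 := pow_ne_zero 2 ha
  rcases s1 with s1 | s1 <;> rcases s2 with s2 | s2 <;> rw [s1, s2] at s3
  · exact ext4 0 (by simp [vertexMatrix, h0]) (by simp [vertexMatrix, s1])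
      (by simp [vertexMatrix, s2])
      (mul_right_cancel₀ ha2 (show _ = a * 1 * a ^ 2 by linear_combination s3))
  · exact ext4 1 (by simp [vertexMatrix, h0]) (by simp [vertexMatrix, s1])
      (by simp [vertexMatrix, s2])
      (mul_right_cancel₀ ha2 (show _ = a * (-1) * a ^ 2 by linear_combination -s3))
  · exact ext4 2 (by simp [vertexMatrix, h0]) (by simp [vertexMatrix, s1])
      (by simp [vertexMatrix, s2])
      (mul_right_cancel₀ ha2 (show _ = a * (-1) * a ^ 2 by linear_combination -s3))
  · exact ext4 3 (by simp [vertexMatrix, h0]) (by simp [vertexMatrix, s1])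
      (by simp [vertexMatrix, s2])
      (mul_right_cancel₀ ha2 (show _ = a * 1 * a ^ 2 by linear_combination s3))

/-- A matrix preserving the Roman surface permutes the vertices of the tetrahedron. -/
theorem exists_mulVec_vertex {A : GL (Fin 4) ℂ}
    (hA : ∀ z, romanQ z = 0 → romanQ (A.val *ᵥ z) = 0) :
    ∃ a : ℂ, a ≠ 0 ∧ ∀ i, ∃ k, A.val *ᵥ vertexMatrix.col i = a • vertexMatrix.col k := by
  obtain ⟨a, b, c, τ, ha, hc, h⟩ := exists_monomial hA
  obtain ⟨rfl, h01, h02, h12⟩ := monomial_coefficients (a := a) (b := b) hc fun z hz => by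
    rw [← hA z hz, romanQ_eq_symmetric (A.val *ᵥ z),
      ← Equiv.sum_comp τ fun j => (A.val *ᵥ z) j.succ ^ 2,
      ← Equiv.sum_comp τ fun j => (A.val *ᵥ z) j.succ ^ 4,
      ← Equiv.prod_comp τ fun j => (A.val *ᵥ z) j.succ, (h z).1]
    simp only [(h z).2]
    simp [romanQ, Fin.sum_univ_three, Fin.prod_univ_three]
    ring
  have hsq : ∀ j, c j ^ 2 = a ^ 2 := by
    have s0 : c 0 ^ 2 = a ^ 2 := mul_right_cancel₀ (mul_ne_zero (hc 1) (hc 2)) (by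
      linear_combination c 0 * c 2 * h01 + a * c 2 * h02)
    have s1 : c 1 ^ 2 = a ^ 2 := mul_right_cancel₀ (mul_ne_zero (hc 0) (hc 2)) (by
      linear_combination c 1 * c 2 * h01 + a * c 2 * h12)
    have s2 : c 2 ^ 2 = a ^ 2 := mul_right_cancel₀ (mul_ne_zero (hc 0) (hc 1)) (by
      linear_combination c 1 * c 2 * h02 + a * c 1 * h12)
    intro j
    fin_cases j <;> assumption
  have hprod : ∏ j, c j = a ^ 3 := by
    rw [Fin.prod_univ_three]
    linear_combination c 2 * h01 + a * hsq 2
  refine ⟨a, ha, fun i => exists_eq_smul_vertex ha ?_ ?_ ?_⟩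
  · rw [(h _).1]
    simp [vertexMatrix]
    fin_cases i <;> simp
  · intro j
    obtain ⟨j, rfl⟩ := τ.surjective j
    rw [(h _).2, mul_pow, hsq]
    fin_cases i <;> fin_cases j <;> simp [vertexMatrix]
  · rw [← Equiv.prod_comp τ]
    simp only [(h _).2]
    rw [Finset.prod_mul_distrib, hprod]
    fin_cases i <;> simp [vertexMatrix, Fin.prod_univ_three]

theorem exists_eq_smul_tetrahedralGL {A : GL (Fin 4) ℂ}
    (hA : ∀ z, romanQ z = 0 → romanQ (A.val *ᵥ z) = 0) :
    ∃ (a : ℂ) (σ : Equiv.Perm (Fin 4)), A.val = a • (tetrahedralGL σ).val := by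
  obtain ⟨a, ha, h⟩ := exists_mulVec_vertex hA
  choose σ hσ using h
  have hcol : ∀ i, vertexMatrix.col i = vertexGL.val *ᵥ Pi.single i 1 := fun i => by
    rw [mulVec_single_one]
    rfl
  have hinj : Function.Injective σ := by
    intro i j hij
    by_contra hne
    refine mulVec_ne_zero (A * vertexGL) (v := Pi.single i 1 - Pi.single j 1) ?_ ?_
    · intro h0
      simpa [hne] using congrFun h0 i
    · rw [Units.val_mul, ← mulVec_mulVec, mulVec_sub, mulVec_sub, ← hcol, ← hcol, hσ, hσ, hij,
        sub_self]
  refine ⟨a, Equiv.ofBijective σ (Finite.injective_iff_bijective.1 hinj), ?_⟩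
  apply (Units.mul_left_inj vertexGL).1
  rw [smul_mul_assoc]
  erw [tetrahedralGL_mul_vertexGL]
  ext i j
  have := congrFun (hσ j) i
  simp only [Pi.smul_apply, smul_eq_mul, col_apply] at this
  rw [Matrix.smul_apply, smul_eq_mul, mul_apply (N := Equiv.Perm.permMatrix _ _), Finset.sum_eq_single (σ j)]
  · refine Eq.trans this ?_
    simp [PEquiv.toMatrix_apply, Equiv.toPEquiv_apply]
  · intro k _ hk
    simp [PEquiv.toMatrix_apply, Equiv.toPEquiv_apply, Equiv.symm_apply_eq, hk]
  · simp

/-- The action of `S₄` by projective transformations permuting the vertices of the tetrahedron. -/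
noncomputable def tetrahedralPGL : Equiv.Perm (Fin 4) →* PGL4C :=
  (QuotientGroup.mk' _).comp tetrahedralGL

theorem tetrahedralPGL_injective : Function.Injective tetrahedralPGL := by
  rw [injective_iff_map_eq_one]
  intro σ hσ
  have hmem : tetrahedralGL σ ∈ Subgroup.center (GL (Fin 4) ℂ) :=
    (QuotientGroup.eq_one_iff _).1 hσ
  obtain ⟨a, ha⟩ := GeneralLinearGroup.mem_center_iff_val_mem_range_scalar.1 hmem
  have hP : (permMatrixHom (n := Fin 4) (R := ℂ)) σ = Matrix.scalar (Fin 4) a := by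
    have h := tetrahedralGL_mul_vertexGL σ
    rw [← ha, ← (Matrix.scalar_commute a (Commute.all a) vertexMatrix).eq.symm] at h
    exact ((Units.mul_right_inj vertexGL).1 h).symm
  ext i : 1
  by_contra hne
  have := congrFun (congrFun hP (σ i)) i
  have hne' : σ i ≠ i := hne
  simp [PEquiv.toMatrix_apply, Equiv.toPEquiv_apply, hne'] at this

end RomanSurface

open RomanSurface in
/-- The subgroup of `PGL₄(ℂ)` of projective transformations preserving the
Roman surface is isomorphic to the symmetric group on four letters. -/
theorem stmt3 :
    ∃ H : Subgroup PGL4C,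
      (∀ g : PGL4C, g ∈ H ↔
        ∃ A : GL (Fin 4) ℂ, (QuotientGroup.mk A : PGL4C) = g ∧
          act A '' romanV = romanV) ∧
      Nonempty (H ≃* Equiv.Perm (Fin 4)) := by
  refine ⟨tetrahedralPGL.range, fun g => ⟨?_, ?_⟩,
    ⟨(MonoidHom.ofInjective tetrahedralPGL_injective).symm⟩⟩
  · rintro ⟨σ, rfl⟩
    exact ⟨tetrahedralGL σ, rfl, act_image_romanV (romanQ_tetrahedralGL_mulVec σ)⟩
  · rintro ⟨A, rfl, hA⟩
    obtain ⟨a, σ, h⟩ := exists_eq_smul_tetrahedralGL fun z => romanQ_mulVec_eq_zero hA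
    refine ⟨σ, QuotientGroup.eq.2 (GeneralLinearGroup.mem_center_iff_val_mem_range_scalar.2 ⟨a, ?_⟩)⟩
    rw [Units.val_mul, h, mul_smul_comm, Units.inv_mul, Matrix.smul_one_eq_diagonal]
    rfl
end

section
/- Let c₃, c₇ ∈ ℂ be nonzero. Then x₀² divides each of the four polynomials gᵢ(x₀, c₃x₁, x₀, c₇x₂) (i = 0,1,2,3), and all four quotients gᵢ(x₀, c₃x₁, x₀, c₇x₂)/x₀² lie in the ℂ-linear span of {f₀, f₁, f₂, f₃} if and only if c₇ = 2c₃. -/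
open MvPolynomial

/-- The components of `f` as polynomials in `x₀, x₁, x₂`. -/
noncomputable def fP : Fin 4 → MvPolynomial (Fin 3) ℂ :=
  ![X 0 ^ 6 * X 1 ^ 2, X 0 * X 1 ^ 5 * X 2 ^ 2, X 1 ^ 3 * X 2 ^ 5,
    X 0 ^ 5 * X 1 * X 2 ^ 2 + 2 * (X 0 ^ 5 * X 2 ^ 3)]

/-- The components of `g` as polynomials in `y₀, y₁, y₂, y₃`. -/
noncomputable def gP : Fin 4 → MvPolynomial (Fin 4) ℂ :=
  ![X 0 ^ 3 * X 1 ^ 2 * X 2 ^ 5,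
    X 0 ^ 3 * X 1 ^ 2 * X 2 ^ 5 + X 1 ^ 5 * X 2 ^ 3 * X 3 ^ 2,
    X 0 ^ 2 * X 1 ^ 3 * X 3 ^ 5,
    X 0 ^ 4 * X 1 * X 2 ^ 3 * X 3 ^ 2 + X 0 ^ 5 * X 2 ^ 2 * X 3 ^ 3 +
      X 0 ^ 2 * X 1 ^ 3 * X 3 ^ 5]

/-- The substitution `(y₀,y₁,y₂,y₃) = (x₀, c₃x₁, x₀, c₇x₂)` applied to `gᵢ`. -/
noncomputable def gSub (c₃ c₇ : ℂ) (i : Fin 4) : MvPolynomial (Fin 3) ℂ :=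
  aeval ![X 0, C c₃ * X 1, X 0, C c₇ * X 2] (gP i)

/-- The explicit quotients `gᵢ(x₀, c₃x₁, x₀, c₇x₂) / x₀²`. -/
noncomputable def gQuot (c₃ c₇ : ℂ) : Fin 4 → MvPolynomial (Fin 3) ℂ :=
  ![C (c₃ ^ 2) * (X 0 ^ 6 * X 1 ^ 2),
    C (c₃ ^ 2) * (X 0 ^ 6 * X 1 ^ 2) + C (c₃ ^ 5 * c₇ ^ 2) * (X 0 * X 1 ^ 5 * X 2 ^ 2),
    C (c₃ ^ 3 * c₇ ^ 5) * (X 1 ^ 3 * X 2 ^ 5),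
    C (c₃ * c₇ ^ 2) * (X 0 ^ 5 * X 1 * X 2 ^ 2) + C (c₇ ^ 3) * (X 0 ^ 5 * X 2 ^ 3) +
      C (c₃ ^ 3 * c₇ ^ 5) * (X 1 ^ 3 * X 2 ^ 5)]

lemma gSub_eq_mul_gQuot (c₃ c₇ : ℂ) (i : Fin 4) :
    gSub c₃ c₇ i = X 0 ^ 2 * gQuot c₃ c₇ i := by
  fin_cases i <;> simp [gSub, gP, gQuot] <;> ring

lemma eq_two_mul_of_gQuot_mem_span {c₃ c₇ : ℂ} (h₇ : c₇ ≠ 0)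
    (h : gQuot c₃ c₇ 3 ∈ Submodule.span ℂ (Set.range fP)) : c₇ = 2 * c₃ := by
  obtain ⟨a, ha⟩ := (Submodule.mem_span_range_iff_exists_fun ℂ).1 h
  have key (t : ℂ) : a 0 * t ^ 2 + a 1 * t ^ 5 + a 2 * t ^ 3 + (a 3 * t + a 3 * 2) =
      c₃ * c₇ ^ 2 * t + c₇ ^ 3 + c₃ ^ 3 * c₇ ^ 5 * t ^ 3 := by
    simpa [Fin.sum_univ_four, fP, gQuot, smul_eval] using congrArg (eval ![1, t, 1]) ha
  have hconst : 2 * a 3 = c₇ ^ 3 := by linear_combination key 0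
  -- Lagrange interpolation at `t² = 1, 4, 9` of the odd part of `key`
  have hlin : a 3 = c₃ * c₇ ^ 2 := by
    linear_combination (3 / 4) * (key 1 - key (-1)) - (3 / 20) * (key 2 - key (-2)) +
      (1 / 60) * (key 3 - key (-3))
  refine mul_left_cancel₀ (pow_ne_zero 2 h₇) ?_
  linear_combination 2 * hlin - hconst

lemma gQuot_mem_span (c₃ : ℂ) (i : Fin 4) :
    gQuot c₃ (2 * c₃) i ∈ Submodule.span ℂ (Set.range fP) := by
  have hf (j : Fin 4) (a : ℂ) : C a * fP j ∈ Submodule.span ℂ (Set.range fP) := by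
    rw [← smul_eq_C_mul]
    exact Submodule.smul_mem _ a (Submodule.subset_span ⟨j, rfl⟩)
  fin_cases i
  · exact hf 0 _
  · exact add_mem (hf 0 _) (hf 1 _)
  · exact hf 2 _
  · convert add_mem (hf 3 (c₃ * (2 * c₃) ^ 2)) (hf 2 (c₃ ^ 3 * (2 * c₃) ^ 5)) using 1
    have h2 : (C 2 : MvPolynomial (Fin 3) ℂ) = 2 := map_ofNat C 2
    simp [gQuot, fP, h2]
    ring

theorem stmt6 (c₃ c₇ : ℂ) (h₃ : c₃ ≠ 0) (h₇ : c₇ ≠ 0) :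
    (∀ i : Fin 4, (X 0 : MvPolynomial (Fin 3) ℂ) ^ 2 ∣ gSub c₃ c₇ i) ∧
    ((∃ q : Fin 4 → MvPolynomial (Fin 3) ℂ,
        (∀ i : Fin 4, gSub c₃ c₇ i = X 0 ^ 2 * q i) ∧
        ∀ i : Fin 4, q i ∈ Submodule.span ℂ (Set.range fP)) ↔ c₇ = 2 * c₃) := by
  refine ⟨fun i => ⟨_, gSub_eq_mul_gQuot c₃ c₇ i⟩, ?_, ?_⟩
  · rintro ⟨q, hq, hspan⟩
    have hX : (X 0 : MvPolynomial (Fin 3) ℂ) ^ 2 ≠ 0 := pow_ne_zero 2 (X_ne_zero 0)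
    have hq3 : q 3 = gQuot c₃ c₇ 3 :=
      mul_left_cancel₀ hX ((hq 3).symm.trans (gSub_eq_mul_gQuot c₃ c₇ 3))
    exact eq_two_mul_of_gQuot_mem_span h₇ (hq3 ▸ hspan 3)
  · rintro rfl
    exact ⟨_, gSub_eq_mul_gQuot c₃ _, gQuot_mem_span c₃⟩
end

section
/- For (y₀,y₁) ≠ (0,0) and (y₂,y₃) ≠ (0,0) in ℂ², all four polynomials y₀³y₁²y₂⁵, y₀³y₁²y₂⁵ + y₁⁵y₂³y₃², y₀²y₁³y₃⁵, y₀⁴y₁y₂³y₃² + y₀⁵y₂²y₃³ + y₀²y₁³y₃⁵ vanish at (y₀,y₁,y₂,y₃) if and only if the corresponding point ([y₀:y₁],[y₂:y₃]) of ℙ¹(ℂ)×ℙ¹(ℂ) is one of the four points (0:1;0:1), (0:1;1:0), (1:0;0:1), (1:0;1:0). -/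
/-- The parametrization `g : ℂ⁴ → ℂ⁴` of the surface `Y`, in bihomogeneous
coordinates `(y₀ : y₁ ; y₂ : y₃)` on `ℙ¹ × ℙ¹`. -/
noncomputable def gB (y : Fin 4 → ℂ) : Fin 4 → ℂ :=
  ![y 0 ^ 3 * y 1 ^ 2 * y 2 ^ 5,
    y 0 ^ 3 * y 1 ^ 2 * y 2 ^ 5 + y 1 ^ 5 * y 2 ^ 3 * y 3 ^ 2,
    y 0 ^ 2 * y 1 ^ 3 * y 3 ^ 5,
    y 0 ^ 4 * y 1 * y 2 ^ 3 * y 3 ^ 2 + y 0 ^ 5 * y 2 ^ 2 * y 3 ^ 3 +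
      y 0 ^ 2 * y 1 ^ 3 * y 3 ^ 5]

/-- The point `(0:1)` of `ℙ¹(ℂ)`. -/
noncomputable def pt01 : Projectivization ℂ (Fin 2 → ℂ) :=
  Projectivization.mk ℂ ![0, 1] (by intro h; simpa using congrFun h 1)

/-- The point `(1:0)` of `ℙ¹(ℂ)`. -/
noncomputable def pt10 : Projectivization ℂ (Fin 2 → ℂ) :=
  Projectivization.mk ℂ ![1, 0] (by intro h; simpa using congrFun h 0)

theorem mk_eq_pt01_iff (a b : ℂ) (h : (![a, b] : Fin 2 → ℂ) ≠ 0) :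
    Projectivization.mk ℂ ![a, b] h = pt01 ↔ a = 0 := by
  rw [pt01, Projectivization.mk_eq_mk_iff']
  constructor
  · rintro ⟨c, hc⟩
    simpa using (congrFun hc 0).symm
  · rintro rfl
    exact ⟨b, by simp⟩

theorem mk_eq_pt10_iff (a b : ℂ) (h : (![a, b] : Fin 2 → ℂ) ≠ 0) :
    Projectivization.mk ℂ ![a, b] h = pt10 ↔ b = 0 := by
  rw [pt10, Projectivization.mk_eq_mk_iff']
  constructor
  · rintro ⟨c, hc⟩
    simpa using (congrFun hc 1).symm
  · rintro rfl
    exact ⟨a, by simp⟩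

theorem stmt10 (y₀ y₁ y₂ y₃ : ℂ)
    (h₁ : (![y₀, y₁] : Fin 2 → ℂ) ≠ 0) (h₂ : (![y₂, y₃] : Fin 2 → ℂ) ≠ 0) :
    (∀ i : Fin 4, gB ![y₀, y₁, y₂, y₃] i = 0) ↔
      ((Projectivization.mk ℂ ![y₀, y₁] h₁, Projectivization.mk ℂ ![y₂, y₃] h₂) =
          (pt01, pt01) ∨
        (Projectivization.mk ℂ ![y₀, y₁] h₁, Projectivization.mk ℂ ![y₂, y₃] h₂) =
          (pt01, pt10) ∨
        (Projectivization.mk ℂ ![y₀, y₁] h₁, Projectivization.mk ℂ ![y₂, y₃] h₂) =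
          (pt10, pt01) ∨
        (Projectivization.mk ℂ ![y₀, y₁] h₁, Projectivization.mk ℂ ![y₂, y₃] h₂) =
          (pt10, pt10)) := by
  simp only [Prod.mk.injEq, mk_eq_pt01_iff, mk_eq_pt10_iff]
  have h₁' : ¬(y₀ = 0 ∧ y₁ = 0) := by
    rintro ⟨rfl, rfl⟩
    simp at h₁
  have h₂' : ¬(y₂ = 0 ∧ y₃ = 0) := by
    rintro ⟨rfl, rfl⟩
    simp at h₂
  simp only [Fin.forall_fin_succ, gB]
  by_cases a : y₀ = 0 <;> by_cases b : y₁ = 0 <;> by_cases c : y₂ = 0 <;>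
    by_cases d : y₃ = 0 <;> simp_all
end

section
/- For a nonzero vector (x₀,x₁,x₂) ∈ ℂ³, both polynomials x₁² + x₂² and x₂² + x₁x₀ vanish at (x₀,x₁,x₂) if and only if the corresponding point of ℙ²(ℂ) is one of the three points (1:1:i), (1:1:−i), (1:0:0), where i ∈ ℂ satisfies i² = −1. -/
theorem stmt11 (x : Fin 3 → ℂ) (hx : x ≠ 0) :
    ((x 1) ^ 2 + (x 2) ^ 2 = 0 ∧ (x 2) ^ 2 + x 1 * x 0 = 0) ↔
      (Projectivization.mk ℂ x hx =
          Projectivization.mk ℂ ![1, 1, Complex.I] (by intro h; simpa using congrFun h 0) ∨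
        Projectivization.mk ℂ x hx =
          Projectivization.mk ℂ ![1, 1, -Complex.I] (by intro h; simpa using congrFun h 0) ∨
        Projectivization.mk ℂ x hx =
          Projectivization.mk ℂ ![1, 0, 0] (by intro h; simpa using congrFun h 0)) := by
  simp only [Projectivization.mk_eq_mk_iff']
  constructor
  · rintro ⟨h₁, h₂⟩
    have h_split : x 1 * (x 1 - x 0) = 0 := by linear_combination h₁ - h₂
    rcases mul_eq_zero.mp h_split with h | h
    · have h_two : x 2 = 0 := by simpa [h] using h₁
      refine Or.inr (Or.inr ⟨x 0, ?_⟩)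
      ext j
      fin_cases j <;> simp [h, h_two]
    · have h_one : x 1 = x 0 := sub_eq_zero.mp h
      have h_factor : (x 2 - x 0 * Complex.I) * (x 2 + x 0 * Complex.I) = 0 := by
        rw [h_one] at h₁
        linear_combination h₁ - x 0 ^ 2 * Complex.I_sq
      rcases mul_eq_zero.mp h_factor with h' | h'
      · refine Or.inl ⟨x 0, ?_⟩
        ext j
        fin_cases j <;> simp [h_one, sub_eq_zero.mp h']
      · refine Or.inr (Or.inl ⟨x 0, ?_⟩)
        ext j
        fin_cases j <;> simp [h_one, eq_neg_of_add_eq_zero_left h']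
  · rintro (⟨a, rfl⟩ | ⟨a, rfl⟩ | ⟨a, rfl⟩) <;> simp [mul_pow] <;> ring
end

section
/- For a nonzero vector (x₀,x₁,x₂) ∈ ℂ³, all four polynomials x₁³ − x₁²x₀, x₁²x₂, x₁x₂², x₁x₂x₀ + x₂³ − x₂²x₀ vanish at (x₀,x₁,x₂) if and only if the corresponding point of ℙ²(ℂ) is one of the three points (1:0:0), (1:1:0), (1:0:1). -/
/-- The components of the birational map `f : ℙ² ⇢ ℙ³` parametrizing a cubic
surface. -/
noncomputable def fC (x : Fin 3 → ℂ) : Fin 4 → ℂ :=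
  ![x 1 ^ 3 - x 1 ^ 2 * x 0, x 1 ^ 2 * x 2, x 1 * x 2 ^ 2,
    x 1 * x 2 * x 0 + x 2 ^ 3 - x 2 ^ 2 * x 0]

theorem stmt12 (x : Fin 3 → ℂ) (hx : x ≠ 0) :
    (∀ i : Fin 4, fC x i = 0) ↔
      (Projectivization.mk ℂ x hx =
          Projectivization.mk ℂ ![1, 0, 0] (by intro h; simpa using congrFun h 0) ∨
        Projectivization.mk ℂ x hx =
          Projectivization.mk ℂ ![1, 1, 0] (by intro h; simpa using congrFun h 0) ∨
        Projectivization.mk ℂ x hx =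
          Projectivization.mk ℂ ![1, 0, 1] (by intro h; simpa using congrFun h 0)) := by
  simp only [Projectivization.mk_eq_mk_iff', fC, Fin.forall_fin_succ, funext_iff]
  simp only [Matrix.cons_val, Matrix.cons_val_succ, Pi.smul_apply, smul_eq_mul, Fin.succ_zero_eq_one,
    Fin.succ_one_eq_two, IsEmpty.forall_iff, mul_one, mul_zero, and_true]
  constructor
  · rintro ⟨h₁, h₂, -, h₄⟩
    by_cases h1 : x 1 = 0
    · by_cases h2 : x 2 = 0
      · exact Or.inl ⟨x 0, rfl, h1.symm, h2.symm⟩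
      · refine Or.inr (Or.inr ⟨x 0, rfl, h1.symm, ?_⟩)
        have h : x 2 ^ 2 * (x 0 - x 2) = 0 := by linear_combination x 2 * x 0 * h1 - h₄
        simpa [h2, sub_eq_zero] using h
    · have h2 : x 2 = 0 := by simpa [h1] using h₂
      refine Or.inr (Or.inl ⟨x 0, rfl, ?_, h2.symm⟩)
      have h : x 1 ^ 2 * (x 0 - x 1) = 0 := by linear_combination -h₁
      simpa [h1, sub_eq_zero] using h
  · rintro (⟨a, h0, h1, h2⟩ | ⟨a, h0, h1, h2⟩ | ⟨a, h0, h1, h2⟩) <;>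
      rw [← h0, ← h1, ← h2] <;> refine ⟨?_, ?_, ?_, ?_⟩ <;> ring
end

section
/- Let 𝔦, 𝔧 ∈ ℂ satisfy 𝔦² = −1 and 𝔧² = −1/3. For (y₀,y₁) ≠ (0,0) and (y₂,y₃) ≠ (0,0) in ℂ², all five polynomials y₀²y₂² − 3y₁²y₃², y₀²y₂y₃ + 3y₁²y₂y₃, y₀²y₃² + 3y₁²y₃², y₀y₁y₂² + y₀y₁y₃², y₁²y₂² + y₁²y₃² vanish at (y₀,y₁,y₂,y₃) if and only if ([y₀:y₁],[y₂:y₃]) is one of the four points (1:−𝔧;1:𝔦), (1:𝔧;1:−𝔦), (1:−𝔧;1:−𝔦), (1:𝔧;1:𝔦) of ℙ¹(ℂ)×ℙ¹(ℂ). -/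
/-- The components of the birational map `f : ℙ¹×ℙ¹ ⇢ ℙ⁴` whose image projects
to a torus of revolution. -/
noncomputable def tF (y : Fin 4 → ℂ) : Fin 5 → ℂ :=
  ![y 0 ^ 2 * y 2 ^ 2 - 3 * (y 1 ^ 2 * y 3 ^ 2),
    y 0 ^ 2 * y 2 * y 3 + 3 * (y 1 ^ 2 * y 2 * y 3),
    y 0 ^ 2 * y 3 ^ 2 + 3 * (y 1 ^ 2 * y 3 ^ 2),
    y 0 * y 1 * y 2 ^ 2 + y 0 * y 1 * y 3 ^ 2,
    y 1 ^ 2 * y 2 ^ 2 + y 1 ^ 2 * y 3 ^ 2]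

/-- A point of the projective line equals `(1 : c)` iff its slope is `c`. -/
theorem Projectivization.mk_eq_mk_one_iff {K : Type*} [Field K] {a b c : K}
    (h : (![a, b] : Fin 2 → K) ≠ 0) (h' : (![1, c] : Fin 2 → K) ≠ 0) :
    Projectivization.mk K ![a, b] h = Projectivization.mk K ![1, c] h' ↔ b = c * a := by
  rw [Projectivization.mk_eq_mk_iff']
  constructor
  · rintro ⟨t, ht⟩
    have h0 : t = a := by simpa using congrFun ht 0
    have h1 : t * c = b := by simpa using congrFun ht 1
    rw [← h1, h0, mul_comm]
  · rintro rfl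
    exact ⟨a, by ext i; fin_cases i <;> simp [mul_comm]⟩

/-- The common zeros of the components of `tF` on `ℙ¹ × ℙ¹`. -/
theorem tF_eq_zero_iff {y₀ y₁ y₂ y₃ : ℂ}
    (h₁ : (![y₀, y₁] : Fin 2 → ℂ) ≠ 0) (h₂ : (![y₂, y₃] : Fin 2 → ℂ) ≠ 0) :
    (∀ i : Fin 5, tF ![y₀, y₁, y₂, y₃] i = 0) ↔
      y₀ ^ 2 + 3 * y₁ ^ 2 = 0 ∧ y₂ ^ 2 + y₃ ^ 2 = 0 := by
  have h₁' : ¬(y₀ = 0 ∧ y₁ = 0) := by simpa using h₁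
  have h₂' : ¬(y₂ = 0 ∧ y₃ = 0) := by simpa using h₂
  simp only [tF, Fin.forall_fin_succ, IsEmpty.forall_iff, and_true]
  simp only [Matrix.cons_val, Matrix.cons_val_zero, Matrix.cons_val_succ]
  constructor
  · rintro ⟨e₀, -, e₂, -, e₄⟩
    have hy₁ : y₁ ≠ 0 := by
      rintro rfl
      have hy₀ : y₀ ≠ 0 := fun h => h₁' ⟨h, rfl⟩
      exact h₂' ⟨by simpa [hy₀] using e₀, by simpa [hy₀] using e₂⟩
    have hq : y₂ ^ 2 + y₃ ^ 2 = 0 :=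
      (mul_eq_zero.mp (by linear_combination e₄ : y₁ ^ 2 * (y₂ ^ 2 + y₃ ^ 2) = 0)).resolve_left
        (pow_ne_zero 2 hy₁)
    have hy₃ : y₃ ≠ 0 := by
      rintro rfl
      exact h₂' ⟨by simpa using hq, rfl⟩
    exact ⟨(mul_eq_zero.mp (by linear_combination e₂ :
      y₃ ^ 2 * (y₀ ^ 2 + 3 * y₁ ^ 2) = 0)).resolve_left (pow_ne_zero 2 hy₃), hq⟩
  · rintro ⟨hp, hq⟩
    refine ⟨?_, ?_, ?_, ?_, ?_⟩
    · linear_combination y₂ ^ 2 * hp - 3 * y₁ ^ 2 * hq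
    · linear_combination y₂ * y₃ * hp
    · linear_combination y₃ ^ 2 * hp
    · linear_combination y₀ * y₁ * hq
    · linear_combination y₁ ^ 2 * hq

theorem stmt13 (𝔦 𝔧 : ℂ) (h𝔦 : 𝔦 ^ 2 = -1) (h𝔧 : 𝔧 ^ 2 = -(1 / 3))
    (y₀ y₁ y₂ y₃ : ℂ)
    (h₁ : (![y₀, y₁] : Fin 2 → ℂ) ≠ 0) (h₂ : (![y₂, y₃] : Fin 2 → ℂ) ≠ 0) :
    (∀ i : Fin 5, tF ![y₀, y₁, y₂, y₃] i = 0) ↔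
      ((Projectivization.mk ℂ ![y₀, y₁] h₁, Projectivization.mk ℂ ![y₂, y₃] h₂) =
          (Projectivization.mk ℂ ![1, -𝔧] (by intro h; simpa using congrFun h 0),
           Projectivization.mk ℂ ![1, 𝔦] (by intro h; simpa using congrFun h 0)) ∨
        (Projectivization.mk ℂ ![y₀, y₁] h₁, Projectivization.mk ℂ ![y₂, y₃] h₂) =
          (Projectivization.mk ℂ ![1, 𝔧] (by intro h; simpa using congrFun h 0),
           Projectivization.mk ℂ ![1, -𝔦] (by intro h; simpa using congrFun h 0)) ∨
        (Projectivization.mk ℂ ![y₀, y₁] h₁, Projectivization.mk ℂ ![y₂, y₃] h₂) =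
          (Projectivization.mk ℂ ![1, -𝔧] (by intro h; simpa using congrFun h 0),
           Projectivization.mk ℂ ![1, -𝔦] (by intro h; simpa using congrFun h 0)) ∨
        (Projectivization.mk ℂ ![y₀, y₁] h₁, Projectivization.mk ℂ ![y₂, y₃] h₂) =
          (Projectivization.mk ℂ ![1, 𝔧] (by intro h; simpa using congrFun h 0),
           Projectivization.mk ℂ ![1, 𝔦] (by intro h; simpa using congrFun h 0))) := by
  have hp : y₀ ^ 2 + 3 * y₁ ^ 2 = 0 ↔ y₁ = 𝔧 * y₀ ∨ y₁ = -𝔧 * y₀ := by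
    rw [neg_mul, ← sq_eq_sq_iff_eq_or_eq_neg, mul_pow, h𝔧]
    constructor <;> intro h
    · linear_combination h / 3
    · linear_combination 3 * h
  have hq : y₂ ^ 2 + y₃ ^ 2 = 0 ↔ y₃ = 𝔦 * y₂ ∨ y₃ = -𝔦 * y₂ := by
    rw [neg_mul, ← sq_eq_sq_iff_eq_or_eq_neg, mul_pow, h𝔦]
    constructor <;> intro h <;> linear_combination h
  simp only [tF_eq_zero_iff h₁ h₂, Prod.mk.injEq, Projectivization.mk_eq_mk_one_iff, hp, hq]
  tauto
end

section
/- Let 𝔦, 𝔧 ∈ ℂ satisfy 𝔦² = −1 and 𝔧² = −1/3, and let p₁ = (1,−𝔧,1,𝔦), p₂ = (1,𝔧,1,−𝔦), p₃ = (1,−𝔧,1,−𝔦), p₄ = (1,𝔧,1,𝔦) ∈ ℂ⁴. The ℂ-vector space of all bihomogeneous polynomials of bidegree (2,2) in the variable pairs (y₀,y₁) and (y₂,y₃) that vanish at each of p₁, p₂, p₃, p₄ is equal to the ℂ-linear span of the five polynomials y₀²y₂² − 3y₁²y₃², y₀²y₂y₃ + 3y₁²y₂y₃, y₀²y₃² +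 3y₁²y₃², y₀y₁y₂² + y₀y₁y₃², y₁²y₂² + y₁²y₃²; in particular this space has dimension 5. -/
open MvPolynomial

/-- The space of bihomogeneous polynomials of bidegree `(2,2)` in the variable
pairs `(y₀,y₁)` and `(y₂,y₃)`: the span of the nine bidegree-`(2,2)` monomials. -/
noncomputable def bideg22 : Submodule ℂ (MvPolynomial (Fin 4) ℂ) :=
  Submodule.span ℂ
    {X 0 ^ 2 * X 2 ^ 2, X 0 ^ 2 * X 2 * X 3, X 0 ^ 2 * X 3 ^ 2,
     X 0 * X 1 * X 2 ^ 2, X 0 * X 1 * X 2 * X 3, X 0 * X 1 * X 3 ^ 2,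
     X 1 ^ 2 * X 2 ^ 2, X 1 ^ 2 * X 2 * X 3, X 1 ^ 2 * X 3 ^ 2}

/-- The five polynomials parametrizing the torus. -/
noncomputable def fiveSet : Set (MvPolynomial (Fin 4) ℂ) :=
  {X 0 ^ 2 * X 2 ^ 2 - 3 * (X 1 ^ 2 * X 3 ^ 2),
   X 0 ^ 2 * X 2 * X 3 + 3 * (X 1 ^ 2 * X 2 * X 3),
   X 0 ^ 2 * X 3 ^ 2 + 3 * (X 1 ^ 2 * X 3 ^ 2),
   X 0 * X 1 * X 2 ^ 2 + X 0 * X 1 * X 3 ^ 2,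
   X 1 ^ 2 * X 2 ^ 2 + X 1 ^ 2 * X 3 ^ 2}

/-- The five polynomials of `fiveSet`, as a family. -/
noncomputable def fiveFamily : Fin 5 → MvPolynomial (Fin 4) ℂ :=
  ![X 0 ^ 2 * X 2 ^ 2 - 3 * (X 1 ^ 2 * X 3 ^ 2),
    X 0 ^ 2 * X 2 * X 3 + 3 * (X 1 ^ 2 * X 2 * X 3),
    X 0 ^ 2 * X 3 ^ 2 + 3 * (X 1 ^ 2 * X 3 ^ 2),
    X 0 * X 1 * X 2 ^ 2 + X 0 * X 1 * X 3 ^ 2,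
    X 1 ^ 2 * X 2 ^ 2 + X 1 ^ 2 * X 3 ^ 2]

lemma range_fiveFamily : Set.range fiveFamily = fiveSet := by
  simp only [fiveFamily, fiveSet, Matrix.range_cons, Matrix.range_empty, Set.union_empty,
    Set.singleton_union]

lemma linearIndependent_fiveFamily : LinearIndependent ℂ fiveFamily := by
  rw [Fintype.linearIndependent_iff]
  intro c hc
  have heval (v : Fin 4 → ℂ) := congrArg (eval v) hc
  simp only [fiveFamily, Fin.sum_univ_five, smul_eq_C_mul, map_add, map_sub, map_mul, map_pow,
    eval_C, eval_X, map_zero, map_ofNat, Matrix.cons_val] at heval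
  have h₁ := heval ![1, 0, 1, 0]
  have h₂ := heval ![1, 0, 0, 1]
  have h₃ := heval ![0, 1, 1, 0]
  have h₄ := heval ![1, 0, 1, 1]
  have h₅ := heval ![1, 1, 1, 0]
  simp at h₁ h₂ h₃ h₄ h₅
  intro i
  fin_cases i <;> simp <;> grind

/-- A polynomial of bidegree `(2,2)` is a combination of the nine monomials. -/
lemma exists_coeffs_of_mem_bideg22 {P : MvPolynomial (Fin 4) ℂ} (hP : P ∈ bideg22) :
    ∃ a₁ a₂ a₃ a₄ a₅ a₆ a₇ a₈ a₉ : ℂ,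
      P = C a₁ * (X 0 ^ 2 * X 2 ^ 2) + C a₂ * (X 0 ^ 2 * X 2 * X 3) + C a₃ * (X 0 ^ 2 * X 3 ^ 2) +
        C a₄ * (X 0 * X 1 * X 2 ^ 2) + C a₅ * (X 0 * X 1 * X 2 * X 3) +
        C a₆ * (X 0 * X 1 * X 3 ^ 2) + C a₇ * (X 1 ^ 2 * X 2 ^ 2) +
        C a₈ * (X 1 ^ 2 * X 2 * X 3) + C a₉ * (X 1 ^ 2 * X 3 ^ 2) := by
  simp only [bideg22, Submodule.mem_span_insert, Submodule.mem_span_singleton,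
    smul_eq_C_mul] at hP
  obtain ⟨a₁, _, ⟨a₂, _, ⟨a₃, _, ⟨a₄, _, ⟨a₅, _, ⟨a₆, _, ⟨a₇, _, ⟨a₈, _, ⟨a₉, rfl⟩, rfl⟩, rfl⟩,
    rfl⟩, rfl⟩, rfl⟩, rfl⟩, rfl⟩, rfl⟩ := hP
  exact ⟨a₁, a₂, a₃, a₄, a₅, a₆, a₇, a₈, a₉, by ring⟩

lemma fiveSet_subset_bideg22 : fiveSet ⊆ bideg22 := by
  have h3 (p : MvPolynomial (Fin 4) ℂ) : 3 * p = (3 : ℂ) • p := by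
    rw [smul_eq_C_mul, map_ofNat]
  rintro P (rfl | rfl | rfl | rfl | rfl) <;> (try simp only [h3]) <;>
    first
    | refine Submodule.add_mem _ (Submodule.subset_span ?_)
        (Submodule.smul_mem _ _ (Submodule.subset_span ?_)) <;> simp
    | refine Submodule.sub_mem _ (Submodule.subset_span ?_)
        (Submodule.smul_mem _ _ (Submodule.subset_span ?_)) <;> simp
    | refine Submodule.add_mem _ (Submodule.subset_span ?_) (Submodule.subset_span ?_) <;> simp

lemma eval_eq_zero_of_mem_span_fiveSet {s t : ℂ} (hs : s ^ 2 = -(1 / 3)) (ht : t ^ 2 = -1)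
    {P : MvPolynomial (Fin 4) ℂ} (hP : P ∈ Submodule.span ℂ fiveSet) :
    eval ![1, s, 1, t] P = 0 := by
  induction hP using Submodule.span_induction with
  | mem P hP =>
    rcases hP with rfl | rfl | rfl | rfl | rfl <;>
      simp only [map_add, map_sub, map_mul, map_pow, eval_X, map_ofNat, Matrix.cons_val] <;>
      grind
  | zero => simp
  | add P Q _ _ hP hQ => rw [map_add, hP, hQ, add_zero]
  | smul c P _ hP => rw [smul_eval, hP, mul_zero]

theorem stmt14 (𝔦 𝔧 : ℂ) (h𝔦 : 𝔦 ^ 2 = -1) (h𝔧 : 𝔧 ^ 2 = -(1 / 3)) :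
    {P : MvPolynomial (Fin 4) ℂ | P ∈ bideg22 ∧
        eval ![1, -𝔧, 1, 𝔦] P = 0 ∧ eval ![1, 𝔧, 1, -𝔦] P = 0 ∧
        eval ![1, -𝔧, 1, -𝔦] P = 0 ∧ eval ![1, 𝔧, 1, 𝔦] P = 0} =
      ↑(Submodule.span ℂ fiveSet) ∧
    Module.finrank ℂ ↥(Submodule.span ℂ fiveSet) = 5 := by
  have hs' : (-𝔧) ^ 2 = -(1 / 3) := by rw [neg_sq, h𝔧]
  have ht' : (-𝔦) ^ 2 = -1 := by rw [neg_sq, h𝔦]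
  refine ⟨Set.ext fun P => ⟨?_, fun hP => ⟨Submodule.span_le.2 fiveSet_subset_bideg22 hP,
    eval_eq_zero_of_mem_span_fiveSet hs' h𝔦 hP, eval_eq_zero_of_mem_span_fiveSet h𝔧 ht' hP,
    eval_eq_zero_of_mem_span_fiveSet hs' ht' hP, eval_eq_zero_of_mem_span_fiveSet h𝔧 h𝔦 hP⟩⟩, ?_⟩
  · rintro ⟨hP, h₁, h₂, h₃, h₄⟩
    obtain ⟨a₁, a₂, a₃, a₄, a₅, a₆, a₇, a₈, a₉, rfl⟩ := exists_coeffs_of_mem_bideg22 hP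
    simp only [map_add, map_mul, map_pow, eval_C, eval_X, Matrix.cons_val] at h₁ h₂ h₃ h₄
    have hi : 𝔦 ≠ 0 := by rintro rfl; norm_num at h𝔦
    have hj : 𝔧 ≠ 0 := by rintro rfl; norm_num at h𝔧
    have e₅ : a₅ = 0 := by
      have : 𝔧 * 𝔦 * a₅ = 0 := by linear_combination (h₄ + h₂ * (-1) + h₃ - h₁) / 4
      simpa [hi, hj] using this
    have e₈ : a₈ = 3 * a₂ := by
      have : 𝔦 * (a₈ - 3 * a₂) = 0 := by
        linear_combination (-3 / 4) * (h₁ + h₄ - h₂ - h₃) + 3 * 𝔦 * a₈ * h𝔧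
      exact sub_eq_zero.1 ((mul_eq_zero.1 this).resolve_left hi)
    have e₆ : a₆ = a₄ := by
      have : 𝔧 * (a₆ - a₄) = 0 := by
        linear_combination (-1 / 4) * (h₂ + h₄ - h₁ - h₃) + 𝔧 * a₆ * h𝔦
      exact sub_eq_zero.1 ((mul_eq_zero.1 this).resolve_left hj)
    have e₉ : a₉ = -3 * a₁ + 3 * a₃ + a₇ := by
      linear_combination (3 / 4) * (h₁ + h₂ + h₃ + h₄) - 3 * a₃ * h𝔦 - 3 * a₇ * h𝔧
        - 3 * a₉ * (𝔦 ^ 2 * h𝔧 - 1 / 3 * h𝔦)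
    subst e₅ e₈ e₆ e₉
    rw [← range_fiveFamily, SetLike.mem_coe, Submodule.mem_span_range_iff_exists_fun]
    refine ⟨![a₁, a₂, a₃, a₆, a₇], ?_⟩
    simp only [fiveFamily, Fin.sum_univ_five, smul_eq_C_mul, Matrix.cons_val, map_add, map_mul,
      map_neg, map_ofNat, map_zero]
    ring
  · rw [← range_fiveFamily, finrank_span_eq_card linearIndependent_fiveFamily, Fintype.card_fin]
end
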